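/- Let 0<δ<1. The half-plane slit map φ^δ(z)=z·(1−δ²−δ²/z²)^{1/2} (principal square root) is injective on the upper half-plane ℍ, maps ℍ into ℍ, and its range is exactly ℍ ∖ {it : 0 < t ≤ δ}, i.e. the upper half-plane with the vertical slit of length δ above the origin removed. (The slit map φ^δ : ℍ → ℍ∖[0,iδ] is a conformal bijection onto the slit half-plane.) -/

import Mathlib

open Complex Filter

/-- The map `f_N(z) = exp(-iz/N)` from the cylinder to the complement of the unit disk. -/
noncomputable def fN (N : ℝ) (z : ℂ) : ℂ := Complex.exp (-Complex.I * z / N)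

/-- The inverse map `f_N⁻¹(w) = iN·Log w` (principal branch). -/
noncomputable def fNinv (N : ℝ) (w : ℂ) : ℂ := Complex.I * N * Complex.log w

/-- The Möbius map `g(z) = i(z-1)/(z+1)`. -/
noncomputable def gMap (z : ℂ) : ℂ := Complex.I * (z - 1) / (z + 1)

/-- The inverse Möbius map `g⁻¹(w) = (i+w)/(i-w)`. -/
noncomputable def gInv (w : ℂ) : ℂ := (Complex.I + w) / (Complex.I - w)

/-- The half-plane slit map `φ^δ(z) = z·(1-δ²-δ²/z²)^{1/2}` (principal square root). -/
noncomputable def phiSlit (δ : ℝ) (z : ℂ) : ℂ :=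
  z * (1 - (δ:ℂ)^2 - (δ:ℂ)^2 / z^2) ^ ((1:ℂ)/2)

/-- The cylindrical slit map `S^{N,δ} = f_N⁻¹∘g⁻¹∘φ^δ∘g∘f_N`. -/
noncomputable def cylSlit (N δ : ℝ) (z : ℂ) : ℂ :=
  fNinv N (gInv (phiSlit δ (gMap (fN N z))))

/-- The slit-size parameter `δ(N,λ) = 1 - 2/(1+e^{λ/N})`. -/
noncomputable def deltaN (N lam : ℝ) : ℝ := 1 - 2 / (1 + Real.exp (lam / N))


/-- The principal square root of a point of the slit plane has positive real part. -/
theorem re_cpow_half_pos {v : ℂ} (hv : v ∈ slitPlane) : 0 < (v ^ ((1 : ℂ) / 2)).re := by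
  rw [cpow_def_of_ne_zero (slitPlane_ne_zero hv), exp_re]
  have him : (log v * ((1 : ℂ) / 2)).im = v.arg / 2 := by
    rw [show (1 : ℂ) / 2 = ((1 / 2 : ℝ) : ℂ) by norm_num, im_mul_ofReal, log_im]
    ring
  rw [him]
  have h₁ := neg_pi_lt_arg v
  have h₂ := lt_of_le_of_ne (arg_le_pi v) (slitPlane_arg_ne_pi hv)
  exact mul_pos (Real.exp_pos _) (Real.cos_pos_of_mem_Ioo ⟨by linarith, by linarith⟩)

theorem cpow_half_sq (v : ℂ) : (v ^ ((1 : ℂ) / 2)) ^ 2 = v := by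
  rw [one_div]
  exact cpow_ofNat_inv_pow v 2

theorem ne_zero_of_im_pos {z : ℂ} (hz : 0 < z.im) : z ≠ 0 := by
  rintro rfl
  simp at hz

/-- Two points of the upper half-plane with the same square coincide. -/
theorem eq_of_sq_eq_sq_of_im_pos {z w : ℂ} (hz : 0 < z.im) (hw : 0 < w.im)
    (h : z ^ 2 = w ^ 2) : z = w := by
  rcases sq_eq_sq_iff_eq_or_eq_neg.mp h with h | h
  · exact h
  · rw [h, neg_im] at hz
    linarith

/-- The square of a point of the upper half-plane is not a nonnegative real number. -/
theorem sq_ne_ofReal_of_im_pos {z : ℂ} (hz : 0 < z.im) {r : ℝ} (hr : 0 ≤ r) :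
    z ^ 2 ≠ (r : ℂ) := by
  intro h
  have him := congrArg im h
  have hre := congrArg re h
  simp only [sq, mul_im, mul_re, ofReal_im, ofReal_re] at him hre
  have hx : z.re = 0 := by
    have : z.re * z.im = 0 := by linarith
    exact (mul_eq_zero.mp this).resolve_right hz.ne'
  rw [hx] at hre
  nlinarith

/-- Every complex number that is not a nonnegative real is the square of a point of the
upper half-plane. -/
theorem exists_im_pos_sq_eq {u : ℂ} (hu : ∀ r : ℝ, 0 ≤ r → u ≠ r) :
    ∃ z : ℂ, 0 < z.im ∧ z ^ 2 = u := by
  have hv : -u ∈ slitPlane := by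
    rw [mem_slitPlane_iff]
    by_contra! h
    refine hu u.re (by simpa using h.1) (Complex.ext rfl ?_)
    simpa using h.2
  refine ⟨I * (-u) ^ ((1 : ℂ) / 2), by simpa using re_cpow_half_pos hv, ?_⟩
  rw [mul_pow, I_sq, cpow_half_sq]
  ring

theorem phiSlit_sq (δ : ℝ) {z : ℂ} (hz : z ≠ 0) :
    phiSlit δ z ^ 2 = ((1 - δ ^ 2 : ℝ) : ℂ) * z ^ 2 - (δ : ℂ) ^ 2 := by
  rw [phiSlit, mul_pow, cpow_half_sq]
  push_cast
  field_simp

theorem one_sub_sq_pos {δ : ℝ} (hδ : 0 < δ) (hδ1 : δ < 1) : 0 < 1 - δ ^ 2 := by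
  nlinarith

theorem phiSlit_radicand_mem_slitPlane {δ : ℝ} (hδ : 0 < δ) (hδ1 : δ < 1) {z : ℂ}
    (hz : 0 < z.im) : 1 - (δ : ℂ) ^ 2 - (δ : ℂ) ^ 2 / z ^ 2 ∈ slitPlane := by
  have hz0 := ne_zero_of_im_pos hz
  have ha := one_sub_sq_pos hδ hδ1
  rw [mem_slitPlane_iff]
  by_contra! h
  set v : ℂ := 1 - (δ : ℂ) ^ 2 - (δ : ℂ) ^ 2 / z ^ 2 with hv
  have hvr : (v.re : ℂ) = v := Complex.ext rfl (by simp [h.2])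
  have hpos : 0 < 1 - δ ^ 2 - v.re := by linarith [h.1]
  have hne : (1 - (δ : ℂ) ^ 2 - v.re) ≠ 0 := by exact_mod_cast hpos.ne'
  refine sq_ne_ofReal_of_im_pos hz (r := δ ^ 2 / (1 - δ ^ 2 - v.re)) (by positivity) ?_
  push_cast
  rw [eq_div_iff hne, hvr, hv]
  field_simp
  ring

theorem phiSlit_im_pos {δ : ℝ} (hδ : 0 < δ) (hδ1 : δ < 1) {z : ℂ} (hz : 0 < z.im) :
    0 < (phiSlit δ z).im := by
  have hs := re_cpow_half_pos (phiSlit_radicand_mem_slitPlane hδ hδ1 hz)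
  have hw := congrArg im (phiSlit_sq δ (ne_zero_of_im_pos hz))
  have ha := one_sub_sq_pos hδ hδ1
  have hinner : 0 < (phiSlit δ z).re * z.re + (phiSlit δ z).im * z.im := by
    rw [phiSlit, mul_re, mul_im]
    nlinarith [mul_pos hs (mul_pos hz hz), mul_nonneg hs.le (sq_nonneg z.re)]
  set w := phiSlit δ z
  have hprod : w.re * w.im = (1 - δ ^ 2) * (z.re * z.im) := by
    rw [sub_im, im_ofReal_mul, ← ofReal_pow, ofReal_im, sq w, sq z, mul_im, mul_im] at hw
    linarith
  by_contra! hneg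
  have hwx : 0 < w.re * z.re := by nlinarith
  have hx : 0 < z.re ^ 2 := by
    have : z.re ≠ 0 := right_ne_zero_of_mul hwx.ne'
    positivity
  have hcontra : (w.re * z.re) ^ 2 * w.im
      = (1 - δ ^ 2) * z.im * z.re ^ 2 * (w.re * z.re) := by
    linear_combination w.re * z.re ^ 2 * hprod
  have hright : 0 < (1 - δ ^ 2) * z.im * z.re ^ 2 * (w.re * z.re) := by positivity
  have hleft := mul_nonpos_of_nonneg_of_nonpos (sq_nonneg (w.re * z.re)) hneg
  linarith

/-- The slit map `φ^δ` is a conformal bijection from the upper half-plane onto the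
half-plane with the vertical slit of length `δ` above the origin removed. -/
theorem phiSlit_conformal_onto_slit_halfPlane (δ : ℝ) (hδ : 0 < δ) (hδ1 : δ < 1) :
    Set.InjOn (phiSlit δ) {z : ℂ | 0 < z.im} ∧
    (∀ z ∈ {z : ℂ | 0 < z.im}, 0 < (phiSlit δ z).im) ∧
    phiSlit δ '' {z : ℂ | 0 < z.im}
      = {w : ℂ | 0 < w.im} \ {w : ℂ | ∃ t : ℝ, 0 < t ∧ t ≤ δ ∧ w = t * Complex.I} := by
  have ha := one_sub_sq_pos hδ hδ1
  have ha0 : ((1 - δ ^ 2 : ℝ) : ℂ) ≠ 0 := ofReal_ne_zero.mpr ha.ne'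
  refine ⟨?_, fun z hz => phiSlit_im_pos hδ hδ1 hz, ?_⟩
  · intro z₁ hz₁ z₂ hz₂ h
    have hsq := congrArg (· ^ 2) h
    simp only [phiSlit_sq δ (ne_zero_of_im_pos hz₁), phiSlit_sq δ (ne_zero_of_im_pos hz₂)]
      at hsq
    exact eq_of_sq_eq_sq_of_im_pos hz₁ hz₂ (mul_left_cancel₀ ha0 (sub_left_injective hsq))
  · ext w
    constructor
    · rintro ⟨z, hz, rfl⟩
      refine ⟨phiSlit_im_pos hδ hδ1 hz, ?_⟩
      rintro ⟨t, ht, htδ, hw⟩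
      have hsq := phiSlit_sq δ (ne_zero_of_im_pos hz)
      rw [hw, mul_pow, I_sq] at hsq
      have hnonneg : 0 ≤ δ ^ 2 - t ^ 2 := by nlinarith
      refine sq_ne_ofReal_of_im_pos hz (r := (δ ^ 2 - t ^ 2) / (1 - δ ^ 2)) (by positivity) ?_
      rw [ofReal_div, eq_div_iff ha0]
      push_cast at hsq ⊢
      linear_combination -hsq
    · rintro ⟨hw, hslit⟩
      obtain ⟨z, hz, hzw⟩ :
          ∃ z : ℂ, 0 < z.im ∧ z ^ 2 = (w ^ 2 + (δ : ℂ) ^ 2) / ((1 - δ ^ 2 : ℝ) : ℂ) := by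
        refine exists_im_pos_sq_eq fun r hr h => hslit ?_
        rw [div_eq_iff ha0] at h
        have hsq : w ^ 2 = ((r * (1 - δ ^ 2) - δ ^ 2 : ℝ) : ℂ) := by
          push_cast at h ⊢
          linear_combination h
        have him := congrArg im hsq
        have hre := congrArg re hsq
        simp only [sq w, mul_im, mul_re, ofReal_im, ofReal_re] at him hre
        have hx : w.re = 0 := by
          have : w.re * w.im = 0 := by linarith
          exact (mul_eq_zero.mp this).resolve_right (ne_of_gt hw)
        refine ⟨w.im, hw, ?_, Complex.ext (by simp [hx]) (by simp)⟩
        rw [hx] at hre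
        refine (abs_le_of_sq_le_sq' ?_ hδ.le).2
        nlinarith [mul_nonneg hr ha.le]
      refine ⟨z, hz, eq_of_sq_eq_sq_of_im_pos (phiSlit_im_pos hδ hδ1 hz) hw ?_⟩
      rw [phiSlit_sq δ (ne_zero_of_im_pos hz), hzw, mul_div_cancel₀ _ ha0]
      ring
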